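/- Assume f : ℝⁿ → ℝ and g : ℝᵐ → ℝ are differentiable convex functions, α, β, ε : [t₀, ∞) → (0, ∞) are C¹, θ > 0 and t₀ > 0 are constants, K : ℝⁿ → ℝᵐ is linear with adjoint K*, α(t) ≥ (1 + θ)/(θ t), β′(t)/β(t) ≤ (1 − 2θ)/(θ t), and α(t) + tα′(t) ≤ tβ(t)ε(t) for all t ≥ t₀, ε is nonincreasing with ∫_{t₀}^∞ tβ(t)ε(t) dt < ∞, and lim_{t→∞} t²β(t) = +∞. Then for every twice continuously differentiable global solution (x(t), y(t)) of the dynamical system (15) there exists a constant C > 0 such that ‖ẋ(t)‖ ≤ C/t and ‖ẏ(t)‖ ≤ C/t for all t ≥ t₀. -/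

import Mathlib

open scoped RealInnerProductSpace
open MeasureTheory Filter Asymptotics

noncomputable section

/-- The bilinear Lagrangian `L(x, y) = f(x) + ⟨Kx, y⟩ - g(y)`. -/
def Lag {n m : ℕ} (f : EuclideanSpace ℝ (Fin n) → ℝ) (g : EuclideanSpace ℝ (Fin m) → ℝ)
    (K : EuclideanSpace ℝ (Fin n) →L[ℝ] EuclideanSpace ℝ (Fin m))
    (x : EuclideanSpace ℝ (Fin n)) (y : EuclideanSpace ℝ (Fin m)) : ℝ :=
  f x + ⟪K x, y⟫ - g y

/-- `(x*, y*)` is a saddle point of the Lagrangian `L`: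
`L(x*, y) ≤ L(x*, y*) ≤ L(x, y*)` for all `(x, y)`. -/
def IsSaddle {n m : ℕ} (f : EuclideanSpace ℝ (Fin n) → ℝ) (g : EuclideanSpace ℝ (Fin m) → ℝ)
    (K : EuclideanSpace ℝ (Fin n) →L[ℝ] EuclideanSpace ℝ (Fin m))
    (xs : EuclideanSpace ℝ (Fin n)) (ys : EuclideanSpace ℝ (Fin m)) : Prop :=
  ∀ x y, Lag f g K xs y ≤ Lag f g K xs ys ∧ Lag f g K xs ys ≤ Lag f g K x ys

/-- `(x, y)` is a twice continuously differentiable global solution on `[t₀, ∞)` of the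
Tikhonov regularized second-order primal-dual dynamical system (15):
`ẍ + α(t)ẋ + β(t)[∇f(x) + ε(t)x + K*(y + θtẏ)] = 0`,
`ÿ + α(t)ẏ − β(t)[K(x + θtẋ) − ∇g(y) − ε(t)y] = 0`. -/
def IsSol {n m : ℕ} (t₀ θ : ℝ)
    (f : EuclideanSpace ℝ (Fin n) → ℝ) (g : EuclideanSpace ℝ (Fin m) → ℝ)
    (K : EuclideanSpace ℝ (Fin n) →L[ℝ] EuclideanSpace ℝ (Fin m))
    (α β ε : ℝ → ℝ)
    (x : ℝ → EuclideanSpace ℝ (Fin n)) (y : ℝ → EuclideanSpace ℝ (Fin m)) : Prop :=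
  ContDiffOn ℝ 2 x (Set.Ici t₀) ∧ ContDiffOn ℝ 2 y (Set.Ici t₀) ∧
  ∀ t ≥ t₀,
    deriv (deriv x) t + α t • deriv x t
      + β t • (gradient f (x t) + ε t • x t
        + (ContinuousLinearMap.adjoint K) (y t + (θ * t) • deriv y t)) = 0 ∧
    deriv (deriv y) t + α t • deriv y t
      - β t • (K (x t + (θ * t) • deriv x t) - gradient g (y t) - ε t • y t) = 0

lemma energy_part {E : Type*} [NormedAddCommGroup E] [InnerProductSpace ℝ E] [CompleteSpace E]
    (θ t : ℝ) (ht : 0 < t) (hθ : 0 < θ) (F : E → ℝ) (G xs w : E) (x x' : ℝ → E) (x'' : E)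
    (α β ε : ℝ → ℝ) (a b e : ℝ)
    (hx : HasDerivAt x (x' t) t) (hx' : HasDerivAt x' x'' t)
    (hF : HasGradientAt F G (x t))
    (ha : HasDerivAt α a t) (hb : HasDerivAt β b t) (he : HasDerivAt ε e t)
    (hβ : 0 < β t) (hε : 0 < ε t) (hα : (1 + θ) / (θ * t) ≤ α t)
    (hb' : b / β t ≤ (1 - 2 * θ) / (θ * t))
    (hae : α t + t * a ≤ t * β t * ε t) (he' : e ≤ 0)
    (hmin : F xs ≤ F (x t))
    (hconv : F (x t) - F xs ≤ ⟪x t - xs, G⟫)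
    (hode : x'' + α t • x' t + β t • (G + ε t • x t + w) = 0) :
    ∃ d, HasDerivAt (fun s => θ ^ 2 * s ^ 2 * β s * (F (x s) - F xs + ε s / 2 * ‖x s‖ ^ 2)
      + 1 / 2 * ‖x s - xs + (θ * s) • x' s‖ ^ 2
      + 1 / 2 * (θ * s * α s - 1 - θ) * ‖x s - xs‖ ^ 2) d t ∧
      d ≤ θ / 2 * ‖xs‖ ^ 2 * (t * β t * ε t)
        - θ * t * β t * ⟪x t - xs + (θ * t) • x' t, w⟫ := by
  have hs : HasDerivAt (fun s : ℝ => s) 1 t := hasDerivAt_id t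
  have hz : HasDerivAt (fun s => x s - xs) (x' t) t := hx.sub_const xs
  have hv : HasDerivAt (fun s => x s - xs + (θ * s) • x' s)
      (x' t + ((θ * t) • x'' + (θ * 1) • x' t)) t :=
    hz.add ((hs.const_mul θ).smul hx')
  have hFx : HasDerivAt (fun s => F (x s)) ⟪G, x' t⟫ t := by
    have := hF.hasFDerivAt.comp_hasDerivAt t hx
    have h2 : (InnerProductSpace.toDual ℝ E) G (x' t) = ⟪G, x' t⟫ :=
      InnerProductSpace.toDual_apply_apply
    rw [h2] at this
    exact this
  have h1 := ((((hs.pow 2).const_mul (θ ^ 2)).mul hb).mul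
    ((hFx.sub_const (F xs)).add ((he.div_const 2).mul hx.norm_sq)))
  have h2 := (hv.norm_sq.const_mul (1 / 2 : ℝ))
  have h3 := (((((hs.const_mul θ).mul ha).sub_const 1).sub_const θ).const_mul (1 / 2 : ℝ)).mul
    hz.norm_sq
  refine ⟨_, (h1.add h2).add h3, ?_⟩
  have hx2 : x'' = -(α t • x' t) - β t • (G + ε t • x t + w) := by
    rw [← sub_eq_zero]; rw [← hode]; abel
  have hξ : 0 ≤ θ * t * α t - 1 - θ := by
    rw [div_le_iff₀ (by positivity)] at hα; nlinarith
  have hb2 : θ ^ 2 * (2 * t * β t + t ^ 2 * b) ≤ θ * t * β t := by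
    rw [div_le_div_iff₀ hβ (by positivity)] at hb'
    nlinarith [mul_le_mul_of_nonneg_left hb' (by positivity : 0 ≤ θ * t)]
  have hxs : ‖xs‖ ^ 2 = ‖x t‖ ^ 2 - 2 * ⟪x t - xs, x t⟫ + ‖x t - xs‖ ^ 2 := by
    have : xs = x t - (x t - xs) := by abel
    conv_lhs => rw [this]
    rw [norm_sub_sq_real, real_inner_comm (x t)]
  rw [hxs]
  generalize hzz : x t - xs = z at *
  have hD : 0 ≤ F (x t) - F xs := sub_nonneg.2 hmin
  simp only [Pi.pow_apply, Pi.mul_apply, Pi.add_apply]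
  rw [hx2]
  simp only [inner_add_left, inner_add_right, inner_sub_right, inner_smul_left, inner_smul_right,
    inner_neg_right, smul_add, smul_sub, smul_neg, RCLike.conj_to_real, real_inner_self_eq_norm_sq]
  rw [real_inner_comm (x' t) z, real_inner_comm (x' t) G, real_inner_comm (x' t) (x t)]
  have k1 := mul_nonneg (sub_nonneg.2 hb2)
    (by positivity : 0 ≤ F (x t) - F xs + ε t / 2 * ‖x t‖ ^ 2)
  have k2 := mul_nonneg (by positivity : 0 ≤ θ * t * β t) (sub_nonneg.2 hconv)
  have k3 := mul_nonneg (by positivity : 0 ≤ θ ^ 2 * t ^ 2 * β t * (‖x t‖ ^ 2 / 2))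
    (neg_nonneg.2 he')
  have k4 := mul_nonneg (by positivity : 0 ≤ θ / 2 * ‖z‖ ^ 2) (sub_nonneg.2 hae)
  have k5 := mul_nonneg (by positivity : 0 ≤ θ * t * ‖x' t‖ ^ 2) hξ
  rw [← sub_nonneg]
  refine (add_nonneg (add_nonneg (add_nonneg (add_nonneg k1 k2) k3) k4) k5).trans (le_of_eq ?_)
  push_cast
  ring

lemma convex_grad {E : Type*} [NormedAddCommGroup E] [InnerProductSpace ℝ E] [CompleteSpace E]
    (F : E → ℝ) (hF : ConvexOn ℝ Set.univ F) (G a b : E) (hG : HasGradientAt F G a) :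
    F a - F b ≤ ⟪a - b, G⟫ := by
  have hc : ConvexOn ℝ Set.univ (F ∘ (AffineMap.lineMap a b : ℝ →ᵃ[ℝ] E)) := by
    simpa using hF.comp_affineMap (AffineMap.lineMap a b : ℝ →ᵃ[ℝ] E)
  have hd : HasDerivAt (AffineMap.lineMap a b : ℝ →ᵃ[ℝ] E) (b - a) (0 : ℝ) :=
    AffineMap.hasDerivAt_lineMap
  have hG' : HasFDerivAt F (InnerProductSpace.toDual ℝ E G)
      ((AffineMap.lineMap a b : ℝ →ᵃ[ℝ] E) 0) := by
    simpa using hG.hasFDerivAt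
  have h := hc.le_slope_of_hasDerivAt (Set.mem_univ 0) (Set.mem_univ 1) one_pos
    (hG'.comp_hasDerivAt 0 hd)
  rw [InnerProductSpace.toDual_apply_apply] at h
  simp only [slope_def_field, Function.comp, AffineMap.lineMap_apply_one,
    AffineMap.lineMap_apply_zero, sub_zero, div_one] at h
  have h3 : ⟪a - b, G⟫ = -⟪G, b - a⟫ := by
    rw [real_inner_comm, ← inner_neg_right, neg_sub]
  linarith

lemma int_bound (t₀ t₁ c : ℝ) (h01 : t₀ < t₁) (hc : 0 ≤ c) (e h : ℝ → ℝ)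
    (hd : ∀ t > t₀, ∃ d, HasDerivAt e d t ∧ d ≤ c * h t)
    (hcont : ContinuousOn h (Set.Ioi t₀)) (hpos : ∀ t > t₀, 0 ≤ h t)
    (hint : IntegrableOn h (Set.Ioi t₀)) :
    ∃ M, ∀ t ≥ t₁, e t ≤ M := by
  have hII : ∀ t ≥ t₁, IntervalIntegrable h volume t₁ t := fun t ht =>
    (hcont.mono (fun s hs => by
      rw [Set.uIcc_of_le ht] at hs; exact lt_of_lt_of_le h01 hs.1)).intervalIntegrable
  have hI : ∀ t ≥ t₁, HasDerivAt (fun u => ∫ s in t₁..u, h s) (h t) t := fun t ht =>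
    intervalIntegral.integral_hasDerivAt_right (hII t ht)
      (hcont.stronglyMeasurableAtFilter isOpen_Ioi t (lt_of_lt_of_le h01 ht))
      (hcont.continuousAt (Ioi_mem_nhds (lt_of_lt_of_le h01 ht)))
  choose! d hd1 hd2 using hd
  have hH : ∀ t ≥ t₁, HasDerivAt (fun u => e u - c * ∫ s in t₁..u, h s) (d t - c * h t) t :=
    fun t ht => (hd1 t (lt_of_lt_of_le h01 ht)).sub ((hI t ht).const_mul c)
  have hanti : AntitoneOn (fun u => e u - c * ∫ s in t₁..u, h s) (Set.Ici t₁) := by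
    apply antitoneOn_of_deriv_nonpos (convex_Ici t₁)
    · exact fun t ht => (hH t ht).continuousAt.continuousWithinAt
    · exact fun t ht => (hH t (interior_subset ht)).differentiableAt.differentiableWithinAt
    · intro t ht
      have ht' := interior_subset ht
      rw [(hH t ht').deriv]
      linarith [hd2 t (lt_of_lt_of_le h01 ht')]
  refine ⟨e t₁ + c * ∫ s in Set.Ioi t₀, h s, fun t ht => ?_⟩
  have h1 := hanti (Set.self_mem_Ici) ht ht
  simp only [intervalIntegral.integral_same, mul_zero, sub_zero] at h1
  have h2 : ∫ s in t₁..t, h s ≤ ∫ s in Set.Ioi t₀, h s := by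
    rw [intervalIntegral.integral_of_le ht]
    refine setIntegral_mono_set hint ?_ ?_
    · exact (ae_restrict_iff' measurableSet_Ioi).2 (ae_of_all _ fun s hs => hpos s hs)
    · exact LE.le.eventuallyLE fun s hs => h01.trans hs.1
  nlinarith [mul_le_mul_of_nonneg_left h2 hc]

lemma vel_bound {E : Type*} [NormedAddCommGroup E] [InnerProductSpace ℝ E]
    (θ t₁ M : ℝ) (ht₁ : 0 < t₁) (hθ : 0 < θ) (xs : E) (x x' : ℝ → E)
    (hx : ∀ s ≥ t₁, HasDerivAt x (x' s) s)
    (hM : ∀ s ≥ t₁, ‖x s - xs + (θ * s) • x' s‖ ^ 2 ≤ M) :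
    ∃ C, ∀ s ≥ t₁, s * ‖x' s‖ ≤ C := by
  have hM0 : 0 ≤ M := (sq_nonneg _).trans (hM t₁ le_rfl)
  have hψ : ∀ s ≥ t₁, HasDerivAt (fun s => s ^ (1 / θ) * (‖x s - xs‖ ^ 2 - M))
      (1 / θ * s ^ (1 / θ - 1) * (‖x s - xs‖ ^ 2 - M)
        + s ^ (1 / θ) * (2 * ⟪x s - xs, x' s⟫)) s := fun s hs =>
    (Real.hasDerivAt_rpow_const (Or.inl (by linarith))).mul
      (((hx s hs).sub_const xs).norm_sq.sub_const M)
  have hanti : AntitoneOn (fun s => s ^ (1 / θ) * (‖x s - xs‖ ^ 2 - M)) (Set.Ici t₁) := by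
    apply antitoneOn_of_deriv_nonpos (convex_Ici t₁)
    · exact fun t ht => (hψ t ht).continuousAt.continuousWithinAt
    · exact fun t ht => (hψ t (interior_subset ht)).differentiableAt.differentiableWithinAt
    · intro t ht
      have ht' : t₁ ≤ t := interior_subset ht
      have htp : 0 < t := by linarith
      rw [(hψ t ht').deriv]
      have e1 : t ^ (1 / θ) = t ^ (1 / θ - 1) * t := by
        rw [Real.rpow_sub_one htp.ne']; field_simp
      rw [e1]
      have hP : 0 < t ^ (1 / θ - 1) := Real.rpow_pos_of_pos htp _
      have hexp : ‖x t - xs + (θ * t) • x' t‖ ^ 2 = ‖x t - xs‖ ^ 2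
          + 2 * (θ * t * ⟪x t - xs, x' t⟫) + ‖(θ * t) • x' t‖ ^ 2 := by
        rw [norm_add_sq_real, inner_smul_right]
      have key : ‖x t - xs‖ ^ 2 - M + θ * t * (2 * ⟪x t - xs, x' t⟫) ≤ 0 := by
        nlinarith [hM t ht', sq_nonneg ‖(θ * t) • x' t‖]
      have e2 : 1 / θ * t ^ (1 / θ - 1) * (‖x t - xs‖ ^ 2 - M)
        + t ^ (1 / θ - 1) * t * (2 * ⟪x t - xs, x' t⟫) = t ^ (1 / θ - 1) / θ *
          (‖x t - xs‖ ^ 2 - M + θ * t * (2 * ⟪x t - xs, x' t⟫)) := by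
        field_simp
      rw [e2]
      exact mul_nonpos_of_nonneg_of_nonpos (by positivity) key
  have hφ : ∀ s ≥ t₁, ‖x s - xs‖ ^ 2 ≤ M + ‖x t₁ - xs‖ ^ 2 := by
    intro s hs
    have h1 := hanti (Set.self_mem_Ici) hs hs
    have hsp : 0 < s := by linarith
    have hp1 : 0 < t₁ ^ (1 / θ) := Real.rpow_pos_of_pos ht₁ _
    have hp2 : t₁ ^ (1 / θ) ≤ s ^ (1 / θ) := Real.rpow_le_rpow ht₁.le hs (by positivity)
    have h2 : s ^ (1 / θ) * (‖x s - xs‖ ^ 2 - M) ≤ s ^ (1 / θ) * ‖x t₁ - xs‖ ^ 2 := by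
      refine h1.trans ?_
      refine (mul_le_mul_of_nonneg_left (sub_le_self _ hM0) hp1.le).trans ?_
      exact mul_le_mul_of_nonneg_right hp2 (sq_nonneg _)
    have h3 := le_of_mul_le_mul_left h2 (hp1.trans_le hp2)
    linarith
  refine ⟨(√M + √(M + ‖x t₁ - xs‖ ^ 2)) / θ, fun s hs => ?_⟩
  rw [le_div_iff₀ hθ]
  have hsp : 0 < s := by linarith
  have a1 : ‖x s - xs + (θ * s) • x' s‖ ≤ √M := Real.le_sqrt_of_sq_le (hM s hs)
  have a2 : ‖x s - xs‖ ≤ √(M + ‖x t₁ - xs‖ ^ 2) := Real.le_sqrt_of_sq_le (hφ s hs)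
  have a3 : ‖(θ * s) • x' s‖ = θ * s * ‖x' s‖ := by
    rw [norm_smul, Real.norm_of_nonneg (by positivity)]
  have a4 : ‖(θ * s) • x' s‖ ≤ ‖x s - xs + (θ * s) • x' s‖ + ‖x s - xs‖ := by
    have := norm_sub_le (x s - xs + (θ * s) • x' s) (x s - xs)
    rwa [add_sub_cancel_left] at this
  nlinarith

lemma near_bound {E : Type*} [NormedAddCommGroup E] [NormedSpace ℝ E]
    (t₀ t₁ C : ℝ) (x : ℝ → E) (hx : ContDiffOn ℝ 2 x (Set.Ici t₀))
    (hC : ∀ s ≥ t₁, s * ‖deriv x s‖ ≤ C) :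
    ∃ C, ∀ s ≥ t₀, s * ‖deriv x s‖ ≤ C := by
  have hc : ContinuousOn (fun s => s * ‖derivWithin x (Set.Ici t₀) s‖) (Set.Icc t₀ t₁) :=
    continuousOn_id.mul (((hx.continuousOn_derivWithin (uniqueDiffOn_Ici t₀)
      (by norm_num)).mono Set.Icc_subset_Ici_self).norm)
  obtain ⟨B, hB⟩ := isCompact_Icc.bddAbove_image hc
  refine ⟨max (max B C) (t₀ * ‖deriv x t₀‖), fun s hs => ?_⟩
  rcases eq_or_lt_of_le hs with rfl | hs'
  · exact le_max_right _ _
  refine le_trans ?_ (le_max_left _ _)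
  rcases le_total s t₁ with h | h
  · refine le_trans ?_ (le_max_left _ _)
    have := hB ⟨s, ⟨hs, h⟩, rfl⟩
    simp only [derivWithin_of_mem_nhds (Ici_mem_nhds hs')] at this
    exact this
  · exact (hC s h).trans (le_max_right _ _)

lemma hasDerivAt_pair {E : Type*} [NormedAddCommGroup E] [NormedSpace ℝ E]
    (t₀ t : ℝ) (ht : t₀ < t) (x : ℝ → E) (hx : ContDiffOn ℝ 2 x (Set.Ici t₀)) :
    HasDerivAt x (deriv x t) t ∧ HasDerivAt (deriv x) (deriv (deriv x) t) t := by
  have h : ContDiffAt ℝ 2 x t := hx.contDiffAt (Ici_mem_nhds ht)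
  refine ⟨(h.differentiableAt (by norm_num)).hasDerivAt, ?_⟩
  have h2 : ContDiffAt ℝ 1 (deriv x) t := by
    have hU : ContDiffOn ℝ 2 x (Set.Ioi t₀) := hx.mono Set.Ioi_subset_Ici_self
    exact (hU.deriv_of_isOpen (m := 1) isOpen_Ioi (by norm_num)).contDiffAt (Ioi_mem_nhds ht)
  exact (h2.differentiableAt (by norm_num)).hasDerivAt

/-- Theorem 3.1, velocity decay: under the fast-decay condition
`∫ tβ(t)ε(t) dt < ∞`, the velocities along any solution of (15) satisfy
`‖ẋ(t)‖ = O(1/t)` and `‖ẏ(t)‖ = O(1/t)`. -/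
theorem stmt_10 {n m : ℕ} (t₀ θ : ℝ) (ht₀ : 0 < t₀) (hθ : 0 < θ)
    (f : EuclideanSpace ℝ (Fin n) → ℝ) (g : EuclideanSpace ℝ (Fin m) → ℝ)
    (hf : Differentiable ℝ f) (hg : Differentiable ℝ g)
    (hfconv : ConvexOn ℝ Set.univ f) (hgconv : ConvexOn ℝ Set.univ g)
    (K : EuclideanSpace ℝ (Fin n) →L[ℝ] EuclideanSpace ℝ (Fin m))
    (α β ε : ℝ → ℝ)
    (hαC1 : ContDiffOn ℝ 1 α (Set.Ici t₀)) (hβC1 : ContDiffOn ℝ 1 β (Set.Ici t₀))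
    (hεC1 : ContDiffOn ℝ 1 ε (Set.Ici t₀))
    (hαpos : ∀ t ≥ t₀, 0 < α t) (hβpos : ∀ t ≥ t₀, 0 < β t) (hεpos : ∀ t ≥ t₀, 0 < ε t)
    (hα : ∀ t ≥ t₀, (1 + θ) / (θ * t) ≤ α t)
    (hβ' : ∀ t ≥ t₀, deriv β t / β t ≤ (1 - 2 * θ) / (θ * t))
    (hαε : ∀ t ≥ t₀, α t + t * deriv α t ≤ t * β t * ε t)
    (hεanti : AntitoneOn ε (Set.Ici t₀))
    (hεint : IntegrableOn (fun t => t * β t * ε t) (Set.Ioi t₀))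
    (hβtop : Tendsto (fun t => t ^ 2 * β t) atTop atTop)
    (hΩ : ∃ p : EuclideanSpace ℝ (Fin n) × EuclideanSpace ℝ (Fin m),
      IsSaddle f g K p.1 p.2)
    (x : ℝ → EuclideanSpace ℝ (Fin n)) (y : ℝ → EuclideanSpace ℝ (Fin m))
    (hsol : IsSol t₀ θ f g K α β ε x y)
    : ∃ C > 0, ∀ t ≥ t₀, ‖deriv x t‖ ≤ C / t ∧ ‖deriv y t‖ ≤ C / t := by
  obtain ⟨⟨xs, ys⟩, hsad⟩ := hΩ
  obtain ⟨hx2, hy2, hode⟩ := hsol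
  simp only [IsSaddle, Lag] at hsad
  have hGx : ∀ a, HasGradientAt (fun a => f a + ⟪K a, ys⟫)
      (gradient f a + (ContinuousLinearMap.adjoint K) ys) a := by
    intro a
    have h1 := (hf a).hasGradientAt.hasFDerivAt
    have h2 : HasFDerivAt (fun a => ⟪K a, ys⟫)
        (InnerProductSpace.toDual ℝ _ ((ContinuousLinearMap.adjoint K) ys)) a := by
      refine (InnerProductSpace.toDual ℝ _
        ((ContinuousLinearMap.adjoint K) ys)).hasFDerivAt.congr_of_eventuallyEq
        (Eventually.of_forall fun b => ?_)
      simp only [InnerProductSpace.toDual_apply_apply]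
      rw [ContinuousLinearMap.adjoint_inner_left, real_inner_comm]
    rw [hasGradientAt_iff_hasFDerivAt, map_add]
    exact h1.add h2
  have hGy : ∀ a, HasGradientAt (fun a => g a - ⟪K xs, a⟫) (gradient g a - K xs) a := by
    intro a
    have h1 := (hg a).hasGradientAt.hasFDerivAt
    have h2 : HasFDerivAt (fun a => ⟪K xs, a⟫) (InnerProductSpace.toDual ℝ _ (K xs)) a :=
      (InnerProductSpace.toDual ℝ _ (K xs)).hasFDerivAt
    rw [hasGradientAt_iff_hasFDerivAt, map_sub]
    exact h1.sub h2
  have hCx : ConvexOn ℝ Set.univ (fun a => f a + ⟪K a, ys⟫) := by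
    refine hfconv.add ⟨convex_univ, fun a _ b _ r s _ _ _ => le_of_eq ?_⟩
    simp [inner_add_left, inner_smul_left]
  have hCy : ConvexOn ℝ Set.univ (fun a => g a - ⟪K xs, a⟫) := by
    refine hgconv.sub ⟨convex_univ, fun a _ b _ r s _ _ _ => le_of_eq ?_⟩
    simp [inner_add_right, inner_smul_right]
  have hmx : ∀ a, f xs + ⟪K xs, ys⟫ ≤ f a + ⟪K a, ys⟫ := fun a => by
    linarith [(hsad a ys).2]
  have hmy : ∀ b, g ys - ⟪K xs, ys⟫ ≤ g b - ⟪K xs, b⟫ := fun b => by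
    linarith [(hsad xs b).1]
  have hdiff : ∀ (φ : ℝ → ℝ), ContDiffOn ℝ 1 φ (Set.Ici t₀) → ∀ t > t₀,
      HasDerivAt φ (deriv φ t) t := fun φ hφ t ht =>
    ((hφ.contDiffAt (Ici_mem_nhds ht)).differentiableAt (by norm_num)).hasDerivAt
  have hε' : ∀ t > t₀, deriv ε t ≤ 0 := fun t ht => by
    rw [← derivWithin_of_mem_nhds (Ici_mem_nhds ht)]
    exact hεanti.derivWithin_nonpos
  have hexy : ∀ t > t₀, ∃ d, HasDerivAt (fun s =>
      (θ ^ 2 * s ^ 2 * β s * ((f (x s) + ⟪K (x s), ys⟫) - (f xs + ⟪K xs, ys⟫)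
          + ε s / 2 * ‖x s‖ ^ 2)
        + 1 / 2 * ‖x s - xs + (θ * s) • deriv x s‖ ^ 2
        + 1 / 2 * (θ * s * α s - 1 - θ) * ‖x s - xs‖ ^ 2)
      + (θ ^ 2 * s ^ 2 * β s * ((g (y s) - ⟪K xs, y s⟫) - (g ys - ⟪K xs, ys⟫)
          + ε s / 2 * ‖y s‖ ^ 2)
        + 1 / 2 * ‖y s - ys + (θ * s) • deriv y s‖ ^ 2
        + 1 / 2 * (θ * s * α s - 1 - θ) * ‖y s - ys‖ ^ 2)) d t ∧
      d ≤ (θ / 2 * ‖xs‖ ^ 2 + θ / 2 * ‖ys‖ ^ 2) * (t * β t * ε t) := by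
    intro t ht
    have hle : t₀ ≤ t := le_of_lt ht
    obtain ⟨hx1, hx1'⟩ := hasDerivAt_pair t₀ t ht x hx2
    obtain ⟨hy1, hy1'⟩ := hasDerivAt_pair t₀ t ht y hy2
    obtain ⟨ho1, ho2⟩ := hode t hle
    obtain ⟨d1, hd1, hd1'⟩ := energy_part θ t (by linarith) hθ _ _ xs
      ((ContinuousLinearMap.adjoint K) (y t - ys + (θ * t) • deriv y t)) x (deriv x) _ α β ε
      _ _ _ hx1 hx1' (hGx (x t)) (hdiff α hαC1 t ht) (hdiff β hβC1 t ht) (hdiff ε hεC1 t ht)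
      (hβpos t hle) (hεpos t hle) (hα t hle) (hβ' t hle) (hαε t hle) (hε' t ht) (hmx (x t))
      (convex_grad _ hCx _ _ _ (hGx (x t))) (by
        rw [← ho1]; congr 2
        simp only [map_add, map_sub]; abel)
    obtain ⟨d2, hd2, hd2'⟩ := energy_part θ t (by linarith) hθ _ _ ys
      (-(K (x t - xs + (θ * t) • deriv x t))) y (deriv y) _ α β ε
      _ _ _ hy1 hy1' (hGy (y t)) (hdiff α hαC1 t ht) (hdiff β hβC1 t ht) (hdiff ε hεC1 t ht)
      (hβpos t hle) (hεpos t hle) (hα t hle) (hβ' t hle) (hαε t hle) (hε' t ht) (hmy (y t))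
      (convex_grad _ hCy _ _ _ (hGy (y t))) (by
        rw [← ho2, sub_eq_add_neg (deriv (deriv y) t + α t • deriv y t), ← smul_neg]; congr 2
        simp only [map_add, map_sub]; abel)
    refine ⟨d1 + d2, hd1.add hd2, ?_⟩
    rw [ContinuousLinearMap.adjoint_inner_right] at hd1'
    rw [inner_neg_right, real_inner_comm] at hd2'
    linarith
  have hcont : ContinuousOn (fun t => t * β t * ε t) (Set.Ioi t₀) :=
    ((continuousOn_id.mul hβC1.continuousOn).mul hεC1.continuousOn).mono Set.Ioi_subset_Ici_self
  obtain ⟨M, hM⟩ := int_bound t₀ (t₀ + 1) _ (by linarith) (by positivity) _ _ hexy hcont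
    (fun t ht => by
      have := hβpos t (le_of_lt ht)
      have := hεpos t (le_of_lt ht)
      have : 0 < t := by linarith
      positivity) hεint
  have hnn : ∀ s ≥ t₀ + 1, ‖x s - xs + (θ * s) • deriv x s‖ ^ 2 ≤ 2 * M ∧
      ‖y s - ys + (θ * s) • deriv y s‖ ^ 2 ≤ 2 * M := by
    intro s hs
    have hle : t₀ ≤ s := by linarith
    have hsp : 0 < s := by linarith
    have hMs := hM s hs
    have hb := hβpos s hle
    have he := hεpos s hle
    have hξ : 0 ≤ θ * s * α s - 1 - θ := by
      have := hα s hle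
      rw [div_le_iff₀ (by positivity)] at this; nlinarith
    have p1 := sub_nonneg.2 (hmx (x s))
    have p2 := sub_nonneg.2 (hmy (y s))
    have q1 : 0 ≤ θ ^ 2 * s ^ 2 * β s * ((f (x s) + ⟪K (x s), ys⟫) - (f xs + ⟪K xs, ys⟫)
          + ε s / 2 * ‖x s‖ ^ 2) := mul_nonneg (by positivity) (add_nonneg p1 (by positivity))
    have q2 : 0 ≤ θ ^ 2 * s ^ 2 * β s * ((g (y s) - ⟪K xs, y s⟫) - (g ys - ⟪K xs, ys⟫)
          + ε s / 2 * ‖y s‖ ^ 2) := mul_nonneg (by positivity) (add_nonneg p2 (by positivity))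
    have q3 : 0 ≤ 1 / 2 * (θ * s * α s - 1 - θ) * ‖x s - xs‖ ^ 2 := by positivity
    have q4 : 0 ≤ 1 / 2 * (θ * s * α s - 1 - θ) * ‖y s - ys‖ ^ 2 := by positivity
    have r1 := sq_nonneg ‖x s - xs + (θ * s) • deriv x s‖
    have r2 := sq_nonneg ‖y s - ys + (θ * s) • deriv y s‖
    constructor <;> linarith
  obtain ⟨C1, hC1⟩ := vel_bound θ (t₀ + 1) (2 * M) (by linarith) hθ xs x (deriv x)
    (fun s hs => (hasDerivAt_pair t₀ s (by linarith) x hx2).1) (fun s hs => (hnn s hs).1)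
  obtain ⟨C2, hC2⟩ := vel_bound θ (t₀ + 1) (2 * M) (by linarith) hθ ys y (deriv y)
    (fun s hs => (hasDerivAt_pair t₀ s (by linarith) y hy2).1) (fun s hs => (hnn s hs).2)
  obtain ⟨D1, hD1⟩ := near_bound t₀ (t₀ + 1) C1 x hx2 hC1
  obtain ⟨D2, hD2⟩ := near_bound t₀ (t₀ + 1) C2 y hy2 hC2
  refine ⟨max 1 (max D1 D2), lt_max_of_lt_left one_pos, fun t ht => ?_⟩
  have htp : 0 < t := by linarith
  rw [le_div_iff₀ htp, le_div_iff₀ htp, mul_comm, mul_comm _ t]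
  exact ⟨(hD1 t ht).trans ((le_max_left _ _).trans (le_max_right _ _)),
    (hD2 t ht).trans ((le_max_right _ _).trans (le_max_right _ _))⟩
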